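/- Let d ≥ 3 be an integer and let ψ : {1, 2, 3, …} → (0, ∞) satisfy ∑_{n ≥ 1} 1/ψ(n) < ∞. Suppose ℓ assigns to every nearest-neighbor edge {x, y} of ℤ^d (i.e., every unordered pair x, y ∈ ℤ^d with ‖x − y‖₁ = 1) a positive number with ℓ({x, y}) ≥ ψ(n)/n^{d−1}, where n is the unique positive integer with n − 1 ≤ ‖(x + y)/2‖₂ < n. Then there exists a function θ : ℤ^d × ℤ^d → ℝ such that: θ(x, y) = −θ(y, x) for all x, y; θ(x, y) = 0 unless ‖x − y‖₁ = 1; ∑_y θ(x, y) = 0 for every x ≠ 0 and ∑_y θ(0, y) = 1; and the energy (1/2) ∑_{x, y : ‖x−y‖₁ = 1} θ(x, y)²/ℓ({x, y}) is finite. -/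

import Mathlib

open Finset

/-- Lattice points (shifted by `c`) of the positive orthant in the Euclidean shell of radii
`n - 1` and `n` number at most a constant times `n ^ (d - 1)`. -/
theorem card_shell_le {d : ℕ} (hd : 1 ≤ d) (c : Fin d → ℝ) (hc : ∀ j, 0 ≤ c j) {n : ℕ}
    (hn : 1 ≤ n) (S : Finset (Fin d → ℕ))
    (hlo : ∀ u ∈ S, ((n : ℝ) - 1) ^ 2 ≤ ∑ j, ((u j : ℝ) + c j) ^ 2)
    (hhi : ∀ u ∈ S, ∑ j, ((u j : ℝ) + c j) ^ 2 < (n : ℝ) ^ 2) :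
    #S ≤ d * ((2 * d + 1) * n ^ (d - 1)) := by
  classical
  have hd' : (1 : ℝ) ≤ d := by exact_mod_cast hd
  have hn' : (1 : ℝ) ≤ n := by exact_mod_cast hn
  let T : Fin d → Finset (Fin d → ℕ) := fun j =>
    {u ∈ S | ((n : ℝ) - 1) ^ 2 ≤ d * ((u j : ℝ) + c j) ^ 2}
  have hST : S ⊆ univ.biUnion T := by
    intro u hu
    by_contra hcon
    simp only [T, mem_biUnion, mem_univ, true_and, mem_filter, hu, not_exists, not_le] at hcon
    have hne : (univ : Finset (Fin d)).Nonempty := ⟨⟨0, hd⟩, mem_univ _⟩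
    have h := Finset.sum_lt_sum_of_nonempty hne fun j _ => hcon j
    rw [← Finset.mul_sum, sum_const, card_univ, Fintype.card_fin, nsmul_eq_mul] at h
    nlinarith [hlo u hu]
  have hT : ∀ j ∈ (univ : Finset (Fin d)), #(T j) ≤ (2 * d + 1) * n ^ (d - 1) := by
    intro j _
    have hcard : #(Fintype.piFinset fun i : Fin d => if i = j then range (2 * d + 1) else range n)
        = (2 * d + 1) * n ^ (d - 1) := by
      rw [Fintype.card_piFinset, ← Finset.mul_prod_erase univ _ (mem_univ j)]
      rw [Finset.prod_congr rfl (g := fun _ => n)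
        (fun i hi => by simp [Finset.ne_of_mem_erase hi])]
      simp
    rw [← hcard]
    refine Finset.card_le_card_of_injOn
      (fun u => Function.update u j (u j % (2 * d + 1))) ?_ ?_
    · intro u hu
      have huS : u ∈ S := (mem_filter.mp hu).1
      refine mem_coe.2 (Fintype.mem_piFinset.mpr fun i => ?_)
      by_cases hij : i = j
      · subst hij
        simpa using Nat.mod_lt (u i) (show 0 < 2 * d + 1 by omega)
      · simp only [Function.update_of_ne hij, hij, if_false, mem_range]
        have h1 : ((u i : ℝ) + c i) ^ 2 ≤ ∑ j, ((u j : ℝ) + c j) ^ 2 :=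
          Finset.single_le_sum (f := fun j => ((u j : ℝ) + c j) ^ 2)
            (fun _ _ => sq_nonneg _) (mem_univ i)
        have h2 := lt_of_pow_lt_pow_left₀ 2 (by positivity) (h1.trans_lt (hhi u huS))
        exact_mod_cast (show (u i : ℝ) < n by linarith [hc i])
    · have key : ∀ u ∈ T j, ∀ v ∈ T j, (∀ i, i ≠ j → u i = v i) →
          u j % (2 * d + 1) = v j % (2 * d + 1) → ¬ u j < v j := by
        intro u hu v hv hne hmod hlt
        obtain ⟨huS, huj⟩ := mem_filter.mp hu
        obtain ⟨hvS, -⟩ := mem_filter.mp hv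
        have hgap : u j + (2 * d + 1) ≤ v j := by
          have h := Nat.le_of_dvd (by omega) ((Nat.modEq_iff_dvd' hlt.le).mp hmod)
          omega
        have hgap' : (u j : ℝ) + (2 * d + 1) ≤ v j := by exact_mod_cast hgap
        have hsum : ∑ i ∈ univ.erase j, ((u i : ℝ) + c i) ^ 2
            = ∑ i ∈ univ.erase j, ((v i : ℝ) + c i) ^ 2 :=
          Finset.sum_congr rfl fun i hi => by rw [hne i (Finset.ne_of_mem_erase hi)]
        have hu1 := hlo u huS
        have hv1 := hhi v hvS
        rw [← Finset.add_sum_erase univ _ (mem_univ j)] at hu1 hv1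
        have ha : 0 ≤ (u j : ℝ) + c j := add_nonneg (Nat.cast_nonneg _) (hc j)
        have hna : (n : ℝ) - 1 ≤ d * ((u j : ℝ) + c j) := by
          refine le_of_sq_le_sq ?_ (by positivity)
          nlinarith [mul_nonneg (sq_nonneg ((u j : ℝ) + c j)) (mul_nonneg (sub_nonneg.2 hd')
            (Nat.cast_nonneg (α := ℝ) d))]
        have hb : (u j : ℝ) + c j + (2 * d + 1) ≤ (v j : ℝ) + c j := by linarith
        have hb2 := pow_le_pow_left₀ (by positivity) hb 2
        nlinarith
      intro u hu v hv huv
      have hne : ∀ i, i ≠ j → u i = v i := fun i hi => by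
        simpa [hi] using congrFun huv i
      have hmod : u j % (2 * d + 1) = v j % (2 * d + 1) := by simpa using congrFun huv j
      funext i
      by_cases hij : i = j
      · subst hij
        exact le_antisymm (not_lt.1 (key v hv u hu (fun i hi => (hne i hi).symm) hmod.symm))
          (not_lt.1 (key u hu v hv hne hmod))
      · exact hne i hij
  calc #S ≤ #(univ.biUnion T) := card_le_card hST
    _ ≤ #(univ : Finset (Fin d)) * ((2 * d + 1) * n ^ (d - 1)) := card_biUnion_le_card_mul _ _ _ hT
    _ = _ := by simp

/-- If the fibre of `f` over `n` has at most `N n` elements and `∑ N n * g n` converges, then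
`∑ g (f u)` converges. -/
theorem summable_comp_of_card_fiber_le {α : Type*} (f : α → ℕ) (g N : ℕ → ℝ)
    (hg : ∀ u, 0 ≤ g (f u)) (hNg : ∀ n, 0 ≤ N n * g n)
    (hN : ∀ n, ∀ S : Finset α, (∀ u ∈ S, f u = n) → (#S : ℝ) ≤ N n)
    (hs : Summable fun n => N n * g n) : Summable fun u => g (f u) := by
  classical
  refine summable_of_sum_le hg (c := ∑' n, N n * g n) fun S => ?_
  rw [← Finset.sum_fiberwise_of_maps_to (g := f) (t := S.image f)
    (fun u hu => mem_image_of_mem f hu)]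
  refine le_trans (Finset.sum_le_sum fun n hn => ?_)
    (hs.sum_le_tsum (S.image f) fun n _ => hNg n)
  obtain ⟨u, -, rfl⟩ := mem_image.mp hn
  rw [Finset.sum_congr rfl (g := fun _ => g (f u))
    (fun v hv => by rw [(mem_filter.mp hv).2]), sum_const, nsmul_eq_mul]
  exact mul_le_mul_of_nonneg_right (hN _ _ fun v hv => (mem_filter.mp hv).2) (hg u)

/-- Probability that the Pólya urn path on the positive orthant of `ℤ^d` uses the edge from `x`
to `x + e_i`: at time `n` the path is uniform on the `(n + d - 1).choose (d - 1)` points with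
coordinate sum `n`, and it then steps in direction `i` with probability `(x i + 1) / (n + d)`. -/
noncomputable def urnWeight {d : ℕ} (x : Fin d → ℤ) (i : Fin d) : ℝ :=
  if ∀ j, 0 ≤ x j then
    ((x i : ℝ) + 1) /
      ((((∑ j, x j).toNat : ℝ) + d) * ((((∑ j, x j).toNat + (d - 1)).choose (d - 1) : ℕ) : ℝ))
  else 0

theorem sum_urnWeight {d : ℕ} (hd : 1 ≤ d) {x : Fin d → ℤ} (hx : ∀ j, 0 ≤ x j) :
    ∑ i, urnWeight x i = 1 / ((((∑ j, x j).toNat + (d - 1)).choose (d - 1) : ℕ) : ℝ) := by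
  have hd' : (1 : ℝ) ≤ d := by exact_mod_cast hd
  simp only [urnWeight, if_pos hx]
  have hcast : (((∑ j, x j).toNat : ℕ) : ℝ) = ∑ j, (x j : ℝ) := by
    have h : (((∑ j, x j).toNat : ℕ) : ℤ) = ∑ j, x j :=
      Int.toNat_of_nonneg (Finset.sum_nonneg fun j _ => hx j)
    exact_mod_cast congrArg (Int.cast (R := ℝ)) h
  rw [← Finset.sum_div, sum_add_distrib, ← hcast]
  have h0 : (0 : ℝ) < ((∑ j, x j).toNat : ℝ) + d := by positivity
  simp only [sum_const, card_univ, Fintype.card_fin, nsmul_eq_mul, mul_one]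
  rw [div_mul_eq_div_div, div_self h0.ne']

theorem sum_urnWeight_sub_single {d : ℕ} (hd : 1 ≤ d) {x : Fin d → ℤ} (hx : ∀ j, 0 ≤ x j)
    (hx0 : x ≠ 0) :
    ∑ i, urnWeight (x - Pi.single i 1) i
      = 1 / ((((∑ j, x j).toNat + (d - 1)).choose (d - 1) : ℕ) : ℝ) := by
  have hsum : 0 < ∑ j, x j := by
    refine lt_of_le_of_ne (Finset.sum_nonneg fun j _ => hx j) fun h => hx0 ?_
    funext j
    exact (Finset.sum_eq_zero_iff_of_nonneg fun j _ => hx j).mp h.symm j (mem_univ j)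
  obtain ⟨m, hm⟩ : ∃ m : ℕ, ∑ j, x j = (m : ℤ) + 1 := ⟨(∑ j, x j - 1).toNat, by omega⟩
  obtain ⟨k, rfl⟩ : ∃ k, d = k + 1 := ⟨d - 1, by omega⟩
  have hterm : ∀ i, urnWeight (x - Pi.single i 1) i
      = (x i : ℝ) / (((m : ℝ) + (k + 1)) * ((m + k).choose k : ℕ)) := by
    intro i
    have hs : ∑ j, (x - Pi.single i 1 : Fin (k + 1) → ℤ) j = (m : ℤ) := by
      simp [hm]
    unfold urnWeight
    split_ifs with h
    · rw [hs]
      simp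
    · have hi : x i = 0 := by
        by_contra hi
        refine h fun j => ?_
        have := hx i
        by_cases hij : j = i
        · subst hij
          simp
          omega
        · simpa [hij] using hx j
      simp [hi]
  have hcast : ∑ j, (x j : ℝ) = (m : ℝ) + 1 := by
    exact_mod_cast congrArg (Int.cast (R := ℝ)) hm
  have hto : (∑ j, x j).toNat = m + 1 := by omega
  rw [Finset.sum_congr rfl fun i _ => hterm i, ← Finset.sum_div, hcast, hto]
  have hch : ((m + k).choose k : ℝ) * (m + k + 1) = ((m + 1 + k).choose k : ℝ) * (m + 1) := by
    have h := Nat.choose_mul_succ_eq (m + k) k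
    rw [show m + k + 1 - k = m + 1 by omega, show m + k + 1 = m + 1 + k by omega] at h
    have h' := congrArg (Nat.cast (R := ℝ)) h
    push_cast at h'
    linarith
  have h1 : (0 : ℝ) < (m + k).choose k := by exact_mod_cast Nat.choose_pos (by omega)
  have h2 : (0 : ℝ) < (m + 1 + k).choose k := by exact_mod_cast Nat.choose_pos (by omega)
  simp only [Nat.add_sub_cancel]
  rw [div_eq_div_iff (by positivity) (by positivity)]
  linarith

theorem urnWeight_nonneg {d : ℕ} (x : Fin d → ℤ) (i : Fin d) : 0 ≤ urnWeight x i := by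
  unfold urnWeight
  split_ifs with h
  · have : (0 : ℝ) ≤ x i := by exact_mod_cast h i
    positivity
  · exact le_rfl

theorem urnWeight_le {d : ℕ} (u : Fin d → ℕ) (i : Fin d) :
    urnWeight (fun j => (u j : ℤ)) i ≤
      ((d - 1).factorial : ℝ) / ((∑ j, (u j : ℝ)) + 1) ^ (d - 1) := by
  have hd : 1 ≤ d := i.pos
  have hx : ∀ j, 0 ≤ (fun j => (u j : ℤ)) j := fun j => by positivity
  have hto : (∑ j, (u j : ℤ)).toNat = ∑ j, u j := by
    rw [← Nat.cast_sum, Int.toNat_natCast]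
  refine (Finset.single_le_sum (fun j _ => urnWeight_nonneg (fun j => (u j : ℤ)) j)
    (mem_univ i)).trans ?_
  rw [sum_urnWeight hd hx, hto]
  have hc : (0 : ℝ) < (∑ j, u j + (d - 1)).choose (d - 1) := by
    exact_mod_cast Nat.choose_pos (by omega)
  rw [div_le_div_iff₀ hc (by positivity), one_mul]
  have h := Nat.pow_succ_le_ascFactorial (∑ j, u j + 1) (d - 1)
  rw [Nat.ascFactorial_eq_factorial_mul_choose] at h
  exact_mod_cast h

/-- The part of the flow oriented away from the origin. -/
noncomputable def urnFlow {d : ℕ} (x y : Fin d → ℤ) : ℝ :=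
  ∑ i, if y = x + Pi.single i 1 then urnWeight x i else 0

theorem hasSum_urnFlow_right {d : ℕ} (x : Fin d → ℤ) :
    HasSum (fun y => urnFlow x y) (∑ i, urnWeight x i) :=
  hasSum_sum fun i _ => hasSum_ite_eq (x + Pi.single i 1) (urnWeight x i)

theorem hasSum_urnFlow_left {d : ℕ} (x : Fin d → ℤ) :
    HasSum (fun y => urnFlow y x) (∑ i, urnWeight (x - Pi.single i 1) i) := by
  refine hasSum_sum fun i _ => ?_
  convert hasSum_ite_eq (x - Pi.single i 1) (urnWeight (x - Pi.single i 1) i) using 2 with y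
  by_cases h : y = x - Pi.single i 1
  · simp [h]
  · rw [if_neg h, if_neg fun h' => h (by rw [h', add_sub_cancel_right])]

theorem sum_abs_sub_add_single {d : ℕ} (x : Fin d → ℤ) (i : Fin d) :
    ∑ j, |x j - (x + Pi.single i 1 : Fin d → ℤ) j| = 1 := by
  rw [Finset.sum_eq_single i] <;> simp +contextual

theorem urnFlow_eq_zero {d : ℕ} {x y : Fin d → ℤ} (h : (∑ i, |x i - y i|) ≠ 1) :
    urnFlow x y = 0 := by
  refine Finset.sum_eq_zero fun i _ => if_neg ?_
  rintro rfl
  exact h (sum_abs_sub_add_single x i)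

/-- Along each direction, the outward flow has finite energy. -/
theorem summable_urnWeight_sq_div {d : ℕ} (ψ : ℕ → ℝ)
    (hψpos : ∀ n : ℕ, 1 ≤ n → 0 < ψ n) (hψ : Summable fun n : ℕ => 1 / ψ (n + 1))
    (ℓ : (Fin d → ℤ) → (Fin d → ℤ) → ℝ)
    (hlow : ∀ x y : Fin d → ℤ, (∑ i, |x i - y i|) = 1 →
      ∀ n : ℕ, 1 ≤ n →
        (n : ℝ) - 1 ≤
            ‖(WithLp.equiv 2 (Fin d → ℝ)).symm (fun i => ((x i : ℝ) + (y i : ℝ)) / 2)‖ →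
        ‖(WithLp.equiv 2 (Fin d → ℝ)).symm (fun i => ((x i : ℝ) + (y i : ℝ)) / 2)‖ < n →
        ψ n / (n : ℝ) ^ (d - 1) ≤ ℓ x y) (i : Fin d) :
    Summable fun u : Fin d → ℕ => urnWeight (fun j => (u j : ℤ)) i ^ 2 /
      ℓ (fun j => (u j : ℤ)) ((fun j => (u j : ℤ)) + Pi.single i 1) := by
  have hd : 1 ≤ d := i.pos
  let c : Fin d → ℝ := Pi.single i (1 / 2)
  have hc : ∀ j, 0 ≤ c j := fun j => by
    by_cases h : j = i
    · subst h; simp [c]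
    · simp [c, h]
  let r : (Fin d → ℕ) → ℝ := fun u => √(∑ j, ((u j : ℝ) + c j) ^ 2)
  have hr0 : ∀ u, 0 ≤ r u := fun u => Real.sqrt_nonneg _
  have hrsq : ∀ u, r u ^ 2 = ∑ j, ((u j : ℝ) + c j) ^ 2 := fun u =>
    Real.sq_sqrt (Finset.sum_nonneg fun _ _ => sq_nonneg _)
  have hnorm : ∀ u : Fin d → ℕ, ‖(WithLp.equiv 2 (Fin d → ℝ)).symm (fun j =>
      ((((fun j => (u j : ℤ)) j : ℤ) : ℝ) +
        ((((fun j => (u j : ℤ)) + Pi.single i 1 : Fin d → ℤ) j : ℤ) : ℝ)) / 2)‖ = r u := by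
    intro u
    rw [EuclideanSpace.norm_eq]
    refine congrArg Real.sqrt (Finset.sum_congr rfl fun j _ => ?_)
    rw [Real.norm_eq_abs, sq_abs]
    congr 1
    by_cases h : j = i
    · subst h
      simp [c]
      ring
    · simp [c, h]
  let f : (Fin d → ℕ) → ℕ := fun u => ⌊r u⌋₊
  have hflo : ∀ u, (f u : ℝ) ≤ r u := fun u => Nat.floor_le (hr0 u)
  have hfhi : ∀ u, r u < (f u : ℝ) + 1 := fun u => Nat.lt_floor_add_one (r u)
  have hrle : ∀ u, r u ≤ ∑ j, (u j : ℝ) + 1 := by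
    intro u
    have h1 : r u ≤ ∑ j, ((u j : ℝ) + c j) := by
      refine Real.sqrt_le_iff.2 ⟨Finset.sum_nonneg fun j _ => add_nonneg (by positivity) (hc j), ?_⟩
      exact Finset.sum_sq_le_sq_sum_of_nonneg fun j _ => add_nonneg (by positivity) (hc j)
    have h2 : ∑ j, c j = 1 / 2 := by simp [c]
    rw [sum_add_distrib, h2] at h1
    linarith
  clear_value f r
  obtain ⟨K, hK⟩ : ∃ K : ℝ, K = ((d - 1).factorial * 2 ^ (d - 1)) ^ 2 := ⟨_, rfl⟩
  have hK0 : 0 ≤ K := hK ▸ sq_nonneg _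
  have hψ0 : ∀ n : ℕ, 0 < ψ (n + 1) := fun n => hψpos _ (by omega)
  have hcomp : Summable fun u =>
      (fun n : ℕ => K / (((n : ℝ) + 1) ^ (d - 1) * ψ (n + 1))) (f u) := by
    refine summable_comp_of_card_fiber_le f
      (fun n : ℕ => K / (((n : ℝ) + 1) ^ (d - 1) * ψ (n + 1)))
      (fun n => (d : ℝ) * ((2 * d + 1) * ((n : ℝ) + 1) ^ (d - 1))) (fun u => ?_) (fun n => ?_)
      (fun n S hS => ?_) ?_
    · have := hψ0 (f u)
      positivity
    · have := hψ0 n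
      positivity
    · have h := card_shell_le hd c hc (n := n + 1) (by omega) S (fun u hu => ?_) (fun u hu => ?_)
      · exact_mod_cast h
      · rw [← hrsq, ← hS u hu]
        push_cast
        rw [add_sub_cancel_right]
        exact pow_le_pow_left₀ (by positivity) (hflo u) 2
      · rw [← hrsq, ← hS u hu]
        push_cast
        exact pow_lt_pow_left₀ (hfhi u) (hr0 u) (by norm_num)
    · refine (hψ.mul_left (d * (2 * d + 1) * K)).congr fun n => ?_
      have := (hψ0 n).ne'
      have h1 : ((n : ℝ) + 1) ^ (d - 1) ≠ 0 := by positivity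
      field_simp
  have hbound : ∀ u : Fin d → ℕ, ψ (f u + 1) / ((f u : ℝ) + 1) ^ (d - 1) ≤
      ℓ (fun j => (u j : ℤ)) ((fun j => (u j : ℤ)) + Pi.single i 1) := by
    intro u
    have h := hlow _ _ (sum_abs_sub_add_single (fun j => (u j : ℤ)) i) (f u + 1) (by omega)
    rw [hnorm u] at h
    push_cast at h
    exact h (by linarith [hflo u]) (hfhi u)
  have hψf : ∀ u, 0 < ψ (f u + 1) / ((f u : ℝ) + 1) ^ (d - 1) := fun u =>
    div_pos (hψ0 _) (by positivity)
  refine hcomp.of_nonneg_of_le (fun u => ?_) fun u => ?_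
  · exact div_nonneg (sq_nonneg _) ((hψf u).le.trans (hbound u))
  · have hw : urnWeight (fun j => (u j : ℤ)) i ≤
        ((d - 1).factorial * 2 ^ (d - 1)) / ((f u : ℝ) + 1) ^ (d - 1) := by
      refine (urnWeight_le u i).trans ?_
      have h0 : (0 : ℝ) ≤ ∑ j, (u j : ℝ) := by positivity
      rw [div_le_div_iff₀ (by positivity) (by positivity), mul_assoc, ← mul_pow]
      gcongr
      linarith [hflo u, hrle u]
    calc _ ≤ (((d - 1).factorial * 2 ^ (d - 1)) / ((f u : ℝ) + 1) ^ (d - 1)) ^ 2 /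
          (ψ (f u + 1) / ((f u : ℝ) + 1) ^ (d - 1)) :=
        div_le_div₀ (sq_nonneg _) (pow_le_pow_left₀ (urnWeight_nonneg _ _) hw 2) (hψf u) (hbound u)
      _ = _ := by
        have := (hψ0 (f u)).ne'
        have h1 : ((f u : ℝ) + 1) ^ (d - 1) ≠ 0 := by positivity
        rw [hK]
        field_simp

/-- The outward flow has finite energy. -/
theorem summable_urnFlow_sq_div {d : ℕ} (ℓ : (Fin d → ℤ) → (Fin d → ℤ) → ℝ)
    (hpos : ∀ x y : Fin d → ℤ, (∑ i, |x i - y i|) = 1 → 0 < ℓ x y)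
    (hw : ∀ i : Fin d, Summable fun u : Fin d → ℕ => urnWeight (fun j => (u j : ℤ)) i ^ 2 /
      ℓ (fun j => (u j : ℤ)) ((fun j => (u j : ℤ)) + Pi.single i 1)) :
    Summable fun p : (Fin d → ℤ) × (Fin d → ℤ) => urnFlow p.1 p.2 ^ 2 / ℓ p.1 p.2 := by
  have hdir : ∀ i : Fin d, Summable fun p : (Fin d → ℤ) × (Fin d → ℤ) =>
      (if p.2 = p.1 + Pi.single i 1 then urnWeight p.1 i else 0) ^ 2 / ℓ p.1 p.2 := by
    intro i
    let g : (Fin d → ℕ) → (Fin d → ℤ) × (Fin d → ℤ) := fun u =>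
      (fun j => (u j : ℤ), (fun j => (u j : ℤ)) + Pi.single i 1)
    have hg : Function.Injective g := by
      intro u v huv
      funext j
      have h : (u j : ℤ) = v j := congrFun (congrArg Prod.fst huv) j
      exact_mod_cast h
    refine (hg.summable_iff ?_).mp ?_
    · rintro ⟨x, y⟩ hxy
      by_cases h : y = x + Pi.single i 1
      · by_cases hx : ∀ j, 0 ≤ x j
        · refine absurd ⟨fun j => (x j).toNat, ?_⟩ hxy
          have : (fun j => ((x j).toNat : ℤ)) = x := funext fun j => Int.toNat_of_nonneg (hx j)
          simp only [g, this, h]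
        · simp [urnWeight, hx]
      · simp [h]
    · refine (hw i).congr fun u => ?_
      simp [g]
  refine ((summable_sum (s := univ) fun i _ => hdir i).mul_left (d : ℝ)).of_nonneg_of_le
    (fun p => ?_) fun p => ?_
  · by_cases h : (∑ i, |p.1 i - p.2 i|) = 1
    · exact div_nonneg (sq_nonneg _) (hpos _ _ h).le
    · simp [urnFlow_eq_zero h]
  · by_cases h : (∑ i, |p.1 i - p.2 i|) = 1
    · rw [← Finset.sum_div, ← mul_div_assoc]
      refine div_le_div_of_nonneg_right ?_ (hpos _ _ h).le
      simpa [urnFlow] using sq_sum_le_card_mul_sum_sq (s := univ)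
        (f := fun i => if p.2 = p.1 + Pi.single i 1 then urnWeight p.1 i else 0)
    · have hne : ∀ i, p.2 ≠ p.1 + Pi.single i 1 := fun i hi =>
        h (hi ▸ sum_abs_sub_add_single p.1 i)
      simp [urnFlow_eq_zero h, hne]


/-- Transience of weighted `ℤ^d`-lattices, `d ≥ 3`: if `∑ 1/ψ(n) < ∞` and the
conductance of every nearest-neighbor edge `{x, y}` (i.e. `‖x - y‖₁ = 1`) is at least
`ψ n / n^{d-1}`, where `n` is the unique positive integer with
`n - 1 ≤ ‖(x + y)/2‖₂ < n`, then there exists a unit flow `θ` from the origin to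
infinity of finite energy: `θ` is antisymmetric, supported on nearest-neighbor pairs,
has zero divergence away from the origin and divergence `1` at the origin, and
`∑ θ(x,y)² / ℓ{x,y} < ∞`. -/
theorem stmt_13 (d : ℕ) (hd : 3 ≤ d) (ψ : ℕ → ℝ) (hψpos : ∀ n : ℕ, 1 ≤ n → 0 < ψ n)
    (hψ : Summable fun n : ℕ => 1 / ψ (n + 1))
    (ℓ : (Fin d → ℤ) → (Fin d → ℤ) → ℝ)
    (hsymm : ∀ x y, ℓ x y = ℓ y x)
    (hpos : ∀ x y : Fin d → ℤ, (∑ i, |x i - y i|) = 1 → 0 < ℓ x y)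
    (hlow : ∀ x y : Fin d → ℤ, (∑ i, |x i - y i|) = 1 →
      ∀ n : ℕ, 1 ≤ n →
        (n : ℝ) - 1 ≤
            ‖(WithLp.equiv 2 (Fin d → ℝ)).symm (fun i => ((x i : ℝ) + (y i : ℝ)) / 2)‖ →
        ‖(WithLp.equiv 2 (Fin d → ℝ)).symm (fun i => ((x i : ℝ) + (y i : ℝ)) / 2)‖ < n →
        ψ n / (n : ℝ) ^ (d - 1) ≤ ℓ x y) :
    ∃ θ : (Fin d → ℤ) → (Fin d → ℤ) → ℝ,
      (∀ x y, θ x y = -θ y x) ∧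
      (∀ x y : Fin d → ℤ, (∑ i, |x i - y i|) ≠ 1 → θ x y = 0) ∧
      (∀ x : Fin d → ℤ, x ≠ 0 → (∑' y : Fin d → ℤ, θ x y) = 0) ∧
      (∑' y : Fin d → ℤ, θ 0 y) = 1 ∧
      Summable (fun p : (Fin d → ℤ) × (Fin d → ℤ) => θ p.1 p.2 ^ 2 / ℓ p.1 p.2) := by
  have hd1 : 1 ≤ d := by omega
  have hsq := summable_urnFlow_sq_div ℓ hpos (summable_urnWeight_sq_div ψ hψpos hψ ℓ hlow)
  have hdiv : ∀ x : Fin d → ℤ, ∑' y, (urnFlow x y - urnFlow y x)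
      = ∑ i, urnWeight x i - ∑ i, urnWeight (x - Pi.single i 1) i := fun x =>
    ((hasSum_urnFlow_right x).sub (hasSum_urnFlow_left x)).tsum_eq
  refine ⟨fun x y => urnFlow x y - urnFlow y x, fun x y => by ring, fun x y h => ?_,
    fun x hx => ?_, ?_, ?_⟩
  · have h' : (∑ i, |y i - x i|) ≠ 1 := by simpa only [abs_sub_comm] using h
    simp [urnFlow_eq_zero h, urnFlow_eq_zero h']
  · rw [hdiv]
    by_cases h0 : ∀ j, 0 ≤ x j
    · rw [sum_urnWeight hd1 h0, sum_urnWeight_sub_single hd1 h0 hx, sub_self]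
    · have hsub : ∀ i, ¬ ∀ j, 0 ≤ (x - Pi.single i 1 : Fin d → ℤ) j := fun i h => h0 fun j =>
        (h j).trans (by
          by_cases hij : j = i
          · subst hij; simp
          · simp [hij])
      simp [urnWeight, h0, -Pi.sub_apply, hsub]
  · have hsub : ∀ i : Fin d, ¬ ∀ j, 0 ≤ (0 - Pi.single i 1 : Fin d → ℤ) j := fun i h => by
      simpa using h i
    have hin : ∀ i : Fin d, urnWeight ((0 : Fin d → ℤ) - Pi.single i 1) i = 0 := fun i =>
      if_neg (hsub i)
    rw [hdiv, Finset.sum_eq_zero fun i _ => hin i, sum_urnWeight hd1 (x := 0) fun j => le_rfl]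
    simp
  · have hsq' : Summable fun p : (Fin d → ℤ) × (Fin d → ℤ) => urnFlow p.2 p.1 ^ 2 / ℓ p.1 p.2 := by
      refine ((Equiv.prodComm _ _).summable_iff.mpr hsq).congr fun p => ?_
      simp [hsymm p.2 p.1]
    refine ((hsq.add hsq').mul_left 2).of_nonneg_of_le (fun p => ?_) fun p => ?_
    all_goals
      by_cases h : (∑ i, |p.1 i - p.2 i|) = 1
    · exact div_nonneg (sq_nonneg _) (hpos _ _ h).le
    · have h' : (∑ i, |p.2 i - p.1 i|) ≠ 1 := by simpa only [abs_sub_comm] using h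
      simp [urnFlow_eq_zero h, urnFlow_eq_zero h']
    · rw [← add_div, ← mul_div_assoc]
      refine div_le_div_of_nonneg_right ?_ (hpos _ _ h).le
      nlinarith [sq_nonneg (urnFlow p.1 p.2 + urnFlow p.2 p.1)]
    · have h' : (∑ i, |p.2 i - p.1 i|) ≠ 1 := by simpa only [abs_sub_comm] using h
      simp [urnFlow_eq_zero h, urnFlow_eq_zero h']
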